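/- Let M₄ be the 16×16 integer matrix with rows r₁ = (1,1,1,1,1,1,1,1,1,1,1,1,1,1,1,1), r₂ = (0,2,0,0,0,0,0,2,0,0,0,2,0,2,0,0), r₃ = (0,0,2,0,0,0,0,2,0,0,0,2,0,0,2,0), r₄ = (0,0,0,2,0,0,0,2,0,0,0,2,0,0,0,2), r₅ = (0,0,0,0,2,0,0,2,0,0,0,0,0,2,2,0), r₆ = (0,0,0,0,0,2,0,2,0,0,0,0,0,2,0,2), r₇ = (0,0,0,0,0,0,2,2,0,0,0,0,0,0,2,2), r₈ = 4e₈, r₉ = (0,0,0,0,0,0,0,0,2,0,0,2,0,2,2,0), r₁₀ = (0,0,0,0,0,0,0,0,0,2,0,2,0,2,0,2), r₁₁ = (0,0,0,0,0,0,0,0,0,0,2,2,0,0,2,2), r₁₂ = 4e₁₂, r₁₃ = (0,0,0,0,0,0,0,0,0,0,0,0,2,2,2,2), r₁₄ = 4e₁₄, r₁₅ = 4e₁₅, r₁₆ = 4e₁₆ (eᵢ the standard basis vectors). If v is a nonzero vector in the ℤ-span of the rows of M₄ all of whose coordinates lie in {−2, 0, 2}, then v has at least 4 nonzero coordinates. 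-/

import Mathlib

/-- The rows of the generator matrix `M₄` of (4 times) the lattice `Λ` of the paper. -/
def M4rows : Fin 16 → Fin 16 → ℤ :=
  ![![1,1,1,1,1,1,1,1,1,1,1,1,1,1,1,1],
    ![0,2,0,0,0,0,0,2,0,0,0,2,0,2,0,0],
    ![0,0,2,0,0,0,0,2,0,0,0,2,0,0,2,0],
    ![0,0,0,2,0,0,0,2,0,0,0,2,0,0,0,2],
    ![0,0,0,0,2,0,0,2,0,0,0,0,0,2,2,0],
    ![0,0,0,0,0,2,0,2,0,0,0,0,0,2,0,2],
    ![0,0,0,0,0,0,2,2,0,0,0,0,0,0,2,2],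
    ![0,0,0,0,0,0,0,4,0,0,0,0,0,0,0,0],
    ![0,0,0,0,0,0,0,0,2,0,0,2,0,2,2,0],
    ![0,0,0,0,0,0,0,0,0,2,0,2,0,2,0,2],
    ![0,0,0,0,0,0,0,0,0,0,2,2,0,0,2,2],
    ![0,0,0,0,0,0,0,0,0,0,0,4,0,0,0,0],
    ![0,0,0,0,0,0,0,0,0,0,0,0,2,2,2,2],
    ![0,0,0,0,0,0,0,0,0,0,0,0,0,4,0,0],
    ![0,0,0,0,0,0,0,0,0,0,0,0,0,0,4,0],
    ![0,0,0,0,0,0,0,0,0,0,0,0,0,0,0,4]]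

/-- A divisibility condition on a partial coordinate sum passes from generators to their span. -/
theorem dvd_sum_of_mem_span {ι κ : Type*} {r : κ → ι → ℤ} {d : ℤ} {s : Finset ι}
    (h : ∀ k, d ∣ ∑ i ∈ s, r k i) {v : ι → ℤ} (hv : v ∈ Submodule.span ℤ (Set.range r)) :
    d ∣ ∑ i ∈ s, v i := by
  induction hv using Submodule.span_induction with
  | mem x hx =>
    obtain ⟨k, rfl⟩ := hx
    exact h k
  | zero => simp
  | add x y _ _ hx hy => simpa [Finset.sum_add_distrib] using dvd_add hx hy
  | smul a x _ hx => simpa [← Finset.mul_sum] using hx.mul_left a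

theorem even_card_filter_ne_zero {ι : Type*} {s : Finset ι} {v : ι → ℤ}
    (hv : ∀ i, v i ∈ ({-2, 0, 2} : Set ℤ)) (h : 4 ∣ ∑ i ∈ s, v i) :
    Even (s.filter fun i => v i ≠ 0).card := by
  have hmod : (4 : ℤ) ∣ ∑ i ∈ s, (v i - 2 * if v i ≠ 0 then 1 else 0) := by
    refine Finset.dvd_sum fun i _ => ?_
    rcases hv i with h | h | h <;> simp_all
  rw [Finset.sum_sub_distrib, ← Finset.mul_sum, Finset.sum_boole] at hmod
  rw [Nat.even_iff]
  omega

/-- The dual description of the extended Hamming code of length 16: a nonempty set of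
even size that meets every binary-digit hyperplane evenly has at least four elements. -/
theorem four_le_card_of_even_testBit {S : Finset (Fin 16)} (hS : S.Nonempty) (heven : Even S.card)
    (hbit : ∀ b : Fin 4, Even (S.filter fun i => i.val.testBit b).card) : 4 ≤ S.card := by
  by_contra! hlt
  have hpos := hS.card_pos
  have htwo : S.card = 2 := by
    rw [Nat.even_iff] at heven
    omega
  obtain ⟨i, j, hij, rfl⟩ := Finset.card_eq_two.mp htwo
  have hbits : ∀ b : Fin 4, i.val.testBit b = j.val.testBit b := by
    intro b
    have hb := hbit b
    rw [Finset.filter_insert, Finset.filter_singleton] at hb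
    cases hi : i.val.testBit b <;> cases hj : j.val.testBit b <;> simp_all
  have hinj : ∀ i j : Fin 16, (∀ b : Fin 4, i.val.testBit b = j.val.testBit b) → i = j := by
    decide
  exact hij (hinj i j hbits)

theorem stmt_11 :
    ∀ v ∈ Submodule.span ℤ (Set.range M4rows), v ≠ 0 →
      (∀ i : Fin 16, v i ∈ ({-2, 0, 2} : Set ℤ)) →
      4 ≤ (Finset.univ.filter fun i : Fin 16 => v i ≠ 0).card := by
  intro v hv hne hval
  have hsum : ∀ k, 4 ∣ ∑ i, M4rows k i := by decide
  have hbitsum : ∀ (b : Fin 4) (k : Fin 16),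
      4 ∣ ∑ i with i.val.testBit b, M4rows k i := by decide
  refine four_le_card_of_even_testBit ?_
    (even_card_filter_ne_zero hval (dvd_sum_of_mem_span hsum hv)) fun b => ?_
  · obtain ⟨i, hi⟩ := Function.ne_iff.mp hne
    exact ⟨i, by simpa using hi⟩
  · rw [Finset.filter_comm]
    exact even_card_filter_ne_zero hval (dvd_sum_of_mem_span (hbitsum b) hv)
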